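/- Let V be a finite-dimensional real vector space, V = K₀ ⊕ K₁ ⊕ K₂ an internal direct sum of subspaces, and B : V → Dual ℝ V a symmetric linear map with ker B = K₀ and B x ∈ K₂° for every x ∈ K₀ ⊔ K₁. Set K := K₁ ⊔ K₂ and M₁ := (K₀ ⊔ K₂)°. Then the restriction of B to K is injective and maps K bijectively onto range B; moreover, for every μ ∈ M₁, the unique element η ∈ K with B η = μ lies in K₁. -/

import Mathlib

/-- Let `V = K₀ ⊕ K₁ ⊕ K₂` be an internal direct sum of subspaces of a
finite-dimensional real vector space, and `B : V → V*` a symmetric linear map with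
`ker B = K₀` and `B x ∈ K₂°` for every `x ∈ K₀ ⊔ K₁`.  Set `K := K₁ ⊔ K₂` and
`M₁ := (K₀ ⊔ K₂)°`.  Then `B` is injective on `K` and maps `K` bijectively onto
`range B`; moreover, for every `μ ∈ M₁`, the unique `η ∈ K` with `B η = μ` lies
in `K₁`. -/
theorem restricted_symm_map_bijective_and_preimage_mem
    (V : Type*) [AddCommGroup V] [Module ℝ V] [FiniteDimensional ℝ V]
    (K₀ K₁ K₂ : Submodule ℝ V)
    (hinternal : DirectSum.IsInternal (fun i : Fin 3 => ![K₀, K₁, K₂] i))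
    (B : V →ₗ[ℝ] Module.Dual ℝ V) (hB : ∀ x y : V, B x y = B y x)
    (hker : LinearMap.ker B = K₀)
    (hann : ∀ x ∈ K₀ ⊔ K₁, B x ∈ K₂.dualAnnihilator) :
    Set.InjOn B (K₁ ⊔ K₂ : Submodule ℝ V) ∧
    Submodule.map B (K₁ ⊔ K₂) = LinearMap.range B ∧
    (∀ μ ∈ (K₀ ⊔ K₂).dualAnnihilator, ∀ η ∈ K₁ ⊔ K₂, B η = μ → η ∈ K₁) := by
  have htop : K₀ ⊔ (K₁ ⊔ K₂) = ⊤ := by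
    have h := hinternal.submodule_iSup_eq_top
    rw [eq_top_iff, ← h]
    refine iSup_le fun i => ?_
    fin_cases i
    · exact le_sup_left
    · exact le_sup_of_le_right le_sup_left
    · exact le_sup_of_le_right le_sup_right
  have hdis : Disjoint K₀ (K₁ ⊔ K₂) := by
    have h := hinternal.submodule_iSupIndep 0
    refine h.mono_right (sup_le ?_ ?_)
    · exact le_iSup₂_of_le (1 : Fin 3) (by decide) le_rfl
    · exact le_iSup₂_of_le (2 : Fin 3) (by decide) le_rfl
  have hz : ∀ x ∈ K₁ ⊔ K₂, B x = 0 → x = 0 := fun x hx h =>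
    Submodule.disjoint_def.1 hdis x (hker ▸ LinearMap.mem_ker.2 h) hx
  have hdec : ∀ v : V, ∃ a ∈ K₀, ∃ b ∈ K₁ ⊔ K₂, a + b = v := fun v =>
    Submodule.mem_sup.1 (htop ▸ Submodule.mem_top)
  have hk : ∀ x ∈ K₀, B x = 0 := fun x hx => by
    rw [← hker] at hx
    exact hx
  refine ⟨?_, ?_, ?_⟩
  · intro x hx y hy h
    exact sub_eq_zero.1 (hz _ (Submodule.sub_mem _ hx hy) (by rw [map_sub, h, sub_self]))
  · refine le_antisymm LinearMap.map_le_range ?_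
    rintro _ ⟨v, rfl⟩
    obtain ⟨a, ha, b, hb, rfl⟩ := hdec v
    exact ⟨b, hb, by rw [map_add, hk a ha, zero_add]⟩
  · intro μ hμ η hη h
    obtain ⟨a, ha, b, hb, rfl⟩ := Submodule.mem_sup.1 hη
    have hann' : ∀ x ∈ K₀ ⊔ K₁, ∀ y ∈ K₂, B x y = 0 := fun x hx y hy =>
      (Submodule.mem_dualAnnihilator _).1 (hann x hx) y hy
    have hb0 : b = 0 := by
      refine hz b (Submodule.mem_sup_right hb) (LinearMap.ext fun v => ?_)
      obtain ⟨p, hp, q, hq, rfl⟩ := hdec v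
      obtain ⟨r, hr, t, ht, rfl⟩ := Submodule.mem_sup.1 hq
      have h1 : B b p = 0 := by rw [hB]; exact hann' p (Submodule.mem_sup_left hp) b hb
      have h2 : B b r = 0 := by rw [hB]; exact hann' r (Submodule.mem_sup_right hr) b hb
      have h3 : B a t = 0 := hann' a (Submodule.mem_sup_right ha) t ht
      have h4 : μ t = 0 :=
        (Submodule.mem_dualAnnihilator _).1 hμ t (Submodule.mem_sup_right ht)
      rw [← h, map_add, LinearMap.add_apply, h3, zero_add] at h4
      simp [h1, h2, h4]
    rw [hb0, add_zero]
    exact ha
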